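/- arXiv:2408.10036 — 2 statements merged into one kernel-verified Lean document; each statement's English description precedes it below -/
import Mathlib

section
/- Let m, n be positive integers with m ≥ n, let 𝔽 be ℝ or ℂ, and let X, Y be m×n matrices over 𝔽 with X ≠ 0. There exists an invertible Hermitian m×m matrix A over 𝔽 with A X = Y if and only if null X = null Y and Xᴴ Y is Hermitian. -/
open Matrix

/-- A matrix factors through another one on the right if its null space is larger. -/
theorem Matrix.exists_mul_eq_of_mulVec_eq_zero {K m n p : Type*} [Field K] [Fintype m]
    [DecidableEq m] [Fintype n] [DecidableEq n] (X : Matrix m n K) (Y : Matrix p n K)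
    (h : ∀ u, X *ᵥ u = 0 → Y *ᵥ u = 0) : ∃ M : Matrix p m K, M * X = Y := by
  obtain ⟨g, hg⟩ := LinearMap.exists_extend
    ((LinearMap.ker X.mulVecLin).liftQ Y.mulVecLin (fun u hu => h u hu) ∘ₗ
      X.mulVecLin.quotKerEquivRange.symm.toLinearMap)
  refine ⟨LinearMap.toMatrix' g, Matrix.ext_of_mulVec_single fun i => ?_⟩
  rw [← mulVec_mulVec, LinearMap.toMatrix'_mulVec]
  generalize (Pi.single i 1 : n → K) = u
  have := LinearMap.congr_fun hg ⟨X.mulVecLin u, LinearMap.mem_range_self _ u⟩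
  rw [LinearMap.comp_apply, LinearMap.comp_apply, LinearEquiv.coe_coe,
    LinearMap.quotKerEquivRange_symm_apply_image] at this
  exact this

/-- The orthogonal projection onto the column space of a matrix. -/
theorem Matrix.exists_isHermitian_mul_eq_self {𝔽 m n : Type*} [RCLike 𝔽] [Fintype m]
    [Fintype n] [DecidableEq n] (X : Matrix m n 𝔽) :
    ∃ L : Matrix n m 𝔽, (X * L).IsHermitian ∧ X * L * X = X := by
  open scoped ComplexOrder in
  obtain ⟨M, hM⟩ := exists_mul_eq_of_mulVec_eq_zero (Xᴴ * X) X
    fun u hu => (conjTranspose_mul_self_mulVec_eq_zero X u).1 hu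
  have hL : Xᴴ * (X * Mᴴ) = Xᴴ := by
    simpa [conjTranspose_mul, Matrix.mul_assoc] using congrArg conjTranspose hM
  have hP : (X * Mᴴ).IsHermitian := by
    have : X * Mᴴ = M * Xᴴ * (X * Mᴴ) := by
      rw [Matrix.mul_assoc, hL]
      conv_lhs => rw [← hM]
      rw [Matrix.mul_assoc, Matrix.mul_assoc, hL]
    rw [IsHermitian, conjTranspose_mul, conjTranspose_conjTranspose, this, Matrix.mul_assoc, hL]
  refine ⟨Mᴴ, hP, ?_⟩
  simpa [conjTranspose_mul, Matrix.mul_assoc, hP.eq] using congrArg conjTranspose hL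

theorem Matrix.IsHermitian.star_mulVec_dotProduct {R m : Type*} [NonUnitalSemiring R] [StarRing R]
    [Fintype m] {A : Matrix m m R} (hA : A.IsHermitian) (v w : m → R) :
    star (A *ᵥ v) ⬝ᵥ w = star v ⬝ᵥ A *ᵥ w := by
  rw [star_mulVec, hA.eq, dotProduct_mulVec]

/-- A Hermitian matrix can be made invertible by adding a multiple of an orthogonal projection
whose null space meets that of the matrix trivially. -/
theorem Matrix.IsHermitian.exists_isUnit_add_smul {𝔽 m : Type*} [RCLike 𝔽] [Fintype m]
    [DecidableEq m] {A Q : Matrix m m 𝔽} (hA : A.IsHermitian) (hQ : Q.IsHermitian)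
    (hQQ : Q * Q = Q) (h : ∀ z, A *ᵥ z = 0 → Q *ᵥ z = 0 → z = 0) :
    ∃ t : ℕ, IsUnit (A + (t : 𝔽) • Q) := by
  by_contra! hsing
  have (t : ℕ) : ∃ z ≠ 0, (A + (t : 𝔽) • Q) *ᵥ z = 0 := by
    rw [exists_mulVec_eq_zero_iff]
    by_contra hdet
    exact hsing t ((isUnit_iff_isUnit_det _).2 (isUnit_iff_ne_zero.2 hdet))
  choose z hz0 hz using this
  have hAz (t : ℕ) : A *ᵥ z t = -((t : 𝔽) • Q *ᵥ z t) := by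
    have := hz t
    rw [add_mulVec, smul_mulVec] at this
    exact eq_neg_of_add_eq_zero_left this
  refine Module.Finite.not_linearIndependent_of_infinite (R := 𝔽)
    (fun t => WithLp.toLp 2 (Q *ᵥ z t) : ℕ → EuclideanSpace 𝔽 m)
    (linearIndependent_of_ne_zero_of_inner_eq_zero (𝕜 := 𝔽) (fun t ht => ?_) fun s t hst => ?_)
  · have hQz : Q *ᵥ z t = 0 := by simpa using ht
    exact hz0 t (h _ (by rw [hAz, hQz, smul_zero, neg_zero]) hQz)
  · beta_reduce
    rw [EuclideanSpace.inner_toLp_toLp, dotProduct_comm, hQ.star_mulVec_dotProduct, mulVec_mulVec,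
      hQQ]
    have key := hA.star_mulVec_dotProduct (z s) (z t)
    rw [hAz, hAz, star_neg, star_smul, neg_dotProduct, smul_dotProduct, dotProduct_neg,
      dotProduct_smul, hQ.star_mulVec_dotProduct, neg_inj, star_natCast, smul_eq_mul,
      smul_eq_mul] at key
    exact (mul_eq_mul_right_iff.1 key).resolve_left (by exact_mod_cast hst)

/-- Invertible Hermitian targeting: there is an invertible Hermitian `A` with
`A X = Y` iff `null X = null Y` and `Xᴴ Y` is Hermitian. -/
theorem stmt_9 {𝔽 : Type*} [RCLike 𝔽] (m n : ℕ) (hn : 0 < n) (hmn : n ≤ m)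
    (X Y : Matrix (Fin m) (Fin n) 𝔽) (hX : X ≠ 0) :
    (∃ A : Matrix (Fin m) (Fin m) 𝔽, IsUnit A ∧ A.IsHermitian ∧ A * X = Y) ↔
      ({u : Fin n → 𝔽 | X.mulVec u = 0} = {u | Y.mulVec u = 0} ∧
        (Xᴴ * Y).IsHermitian) := by
  constructor
  · rintro ⟨A, hA, hAH, rfl⟩
    refine ⟨?_, ?_⟩
    · ext u
      rw [Set.mem_ofPred_eq, Set.mem_ofPred_eq, ← mulVec_mulVec]
      exact ((mulVec_injective_of_isUnit hA).eq_iff' (mulVec_zero A)).symm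
    · simpa [Matrix.mul_assoc] using isHermitian_conjTranspose_mul_mul X hAH
  · rintro ⟨hnull, hXY⟩
    have hnull (u : Fin n → 𝔽) : X *ᵥ u = 0 ↔ Y *ᵥ u = 0 := Set.ext_iff.1 hnull u
    obtain ⟨N, hN⟩ := exists_mul_eq_of_mulVec_eq_zero X Y fun u => (hnull u).1
    obtain ⟨L, hP, hPX⟩ := exists_isHermitian_mul_eq_self X
    obtain ⟨P, hPdef⟩ : ∃ P, P = X * L := ⟨_, rfl⟩
    rw [← hPdef] at hP hPX
    have hPP : P * P = P := by
      conv_lhs => rw [hPdef, ← Matrix.mul_assoc, ← hPdef, hPX, ← hPdef]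
    have hQX : (1 - P) * X = 0 := by rw [Matrix.sub_mul, hPX, Matrix.one_mul, sub_self]
    have hQ : (1 - P).IsHermitian := isHermitian_one.sub hP
    obtain ⟨M, hMdef⟩ : ∃ M, M = Y * L := ⟨_, rfl⟩
    have hMX : M * X = Y := by
      rw [hMdef, ← hN, Matrix.mul_assoc, Matrix.mul_assoc, ← Matrix.mul_assoc X L X, ← hPdef, hPX]
    have hPM : (P * M).IsHermitian := by
      have : P * M = Lᴴ * (Xᴴ * Y) * L := by
        rw [← hP.eq, hPdef, hMdef, conjTranspose_mul]
        simp only [Matrix.mul_assoc]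
      rw [this]
      exact isHermitian_conjTranspose_mul_mul L hXY
    have hA : (M + Mᴴ * (1 - P)).IsHermitian := by
      have hMP : Mᴴ * P = P * M := by
        rw [← hPM.eq, conjTranspose_mul P, hP.eq]
      rw [Matrix.mul_sub, Matrix.mul_one, hMP, ← add_sub_assoc]
      exact (isHermitian_add_transpose_self M).sub hPM
    have hAX : (M + Mᴴ * (1 - P)) * X = Y := by
      rw [Matrix.add_mul, Matrix.mul_assoc, hQX, Matrix.mul_zero, add_zero, hMX]
    obtain ⟨t, ht⟩ := hA.exists_isUnit_add_smul hQ
      (by rw [Matrix.sub_mul, Matrix.mul_sub, Matrix.mul_sub, hPP]; simp) fun z hAz hQz => by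
        have hz : z = X *ᵥ L *ᵥ z := by
          rw [sub_mulVec, one_mulVec, sub_eq_zero] at hQz
          rwa [mulVec_mulVec, ← hPdef]
        rw [hz, mulVec_mulVec, hAX, ← hnull] at hAz
        rw [hz, hAz]
    refine ⟨_, ht, hA.add ?_, ?_⟩
    · rw [IsHermitian, conjTranspose_smul, hQ.eq, star_natCast]
    · rw [Matrix.add_mul, hAX, Matrix.smul_mul, hQX, smul_zero, add_zero]
end

section
/- Let m, n be positive integers with m ≥ n, let X, Y be m×n complex matrices with X ≠ 0, and let λ, μ be distinct complex numbers. Assume that if m = n and (Y = λ X or Y = μ X), then rank X < m. Then there exists a normal m×m complex matrix A (A Aᴴ = Aᴴ A) whose spectrum is contained in {λ, μ} and which satisfies A X = Y, if and only if (Y − λ X)ᴴ (Y − μ X) = 0. -/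
open Matrix

open scoped Matrix.Norms.L2Operator in
/-- A normal matrix with spectrum in `{l, μ}` satisfies `(A - l)ᴴ (A - μ) = 0`. -/
theorem conjTranspose_sub_mul_sub_eq_zero_of_spectrum_subset_pair {m : Type*} [Fintype m]
    [DecidableEq m] {A : Matrix m m ℂ} {l μ : ℂ} (hA : A * Aᴴ = Aᴴ * A)
    (hs : spectrum ℂ A ⊆ {l, μ}) :
    (A - l • (1 : Matrix m m ℂ))ᴴ * (A - μ • (1 : Matrix m m ℂ)) = 0 := by
  have : IsStarNormal A := ⟨hA.symm⟩
  have hsub (c : ℂ) : A - c • (1 : Matrix m m ℂ) = cfc (fun z : ℂ => z - c) A := by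
    rw [cfc_sub (fun z : ℂ => z) (fun _ => c) A, cfc_id' ℂ A, cfc_const c A,
      Algebra.algebraMap_eq_smul_one]
  rw [hsub, hsub, ← star_eq_conjTranspose, ← cfc_star, ← cfc_mul .., ← cfc_zero ℂ A]
  refine cfc_congr fun z hz => ?_
  rcases hs hz with rfl | rfl <;> simp

/-- If the columns of `V` are orthogonal to those of `U`, some orthogonal projection fixes `U`
and annihilates `V`. -/
theorem exists_isHermitian_idempotent_mul_eq_self_and_mul_eq_zero {m n p : Type*} [Fintype m] [DecidableEq m]
    [Fintype n] [DecidableEq n] (U : Matrix m n ℂ) (V : Matrix m p ℂ) (h : Vᴴ * U = 0) :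
    ∃ P : Matrix m m ℂ, P.IsHermitian ∧ P * P = P ∧ P * U = U ∧ P * V = 0 := by
  let K : Submodule ℂ (EuclideanSpace ℂ m) := LinearMap.range (toEuclideanLin U)
  let e := toEuclideanCLM (n := m) (𝕜 := ℂ)
  have he (x : m → ℂ) :
      e.symm K.starProjection *ᵥ x = (K.starProjection (WithLp.toLp 2 x)).ofLp := by
    rw [← ofLp_toEuclideanCLM (𝕜 := ℂ) (e.symm K.starProjection) (WithLp.toLp 2 x)]
    exact congrArg (fun T : EuclideanSpace ℂ m →L[ℂ] EuclideanSpace ℂ m =>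
      (T (WithLp.toLp 2 x)).ofLp) (e.apply_symm_apply K.starProjection)
  refine ⟨e.symm K.starProjection, ?_, ?_, ?_, ?_⟩
  · rw [IsHermitian, ← star_eq_conjTranspose]
    exact (e.symm.map_star' _).symm.trans (congrArg e.symm
      (isSelfAdjoint_starProjection K).star_eq)
  · rw [← map_mul, K.isIdempotentElem_starProjection.eq]
  · ext i j
    have hmem : WithLp.toLp 2 (U.col j) ∈ K :=
      ⟨WithLp.toLp 2 (Pi.single j 1), by rw [toLpLin_toLp, toLin'_apply, mulVec_single_one]⟩
    have := congrFun (he (U.col j)) i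
    rwa [K.starProjection_eq_self_iff.mpr hmem] at this
  · ext i j
    have hmem : WithLp.toLp 2 (V.col j) ∈ Kᗮ := by
      rintro _ ⟨x, rfl⟩
      rw [inner_eq_zero_symm, EuclideanSpace.inner_eq_star_dotProduct]
      have := congrFun (congrArg (· *ᵥ x.ofLp) h) j
      simp only [← mulVec_mulVec, zero_mulVec] at this
      simpa [mulVec, dotProduct, mul_comm, toLpLin_apply] using this
    have := congrFun (he (V.col j)) i
    rwa [K.starProjection_apply_eq_zero_iff.mpr hmem] at this

/-- The spectrum of a matrix annihilated by `(z - l)(z - μ)` lies in `{l, μ}`. -/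
theorem spectrum_subset_pair_of_sub_mul_sub_eq_zero {m : Type*} [Fintype m] [DecidableEq m]
    {A : Matrix m m ℂ} {l μ : ℂ}
    (h : (A - l • (1 : Matrix m m ℂ)) * (A - μ • (1 : Matrix m m ℂ)) = 0) :
    spectrum ℂ A ⊆ {l, μ} := by
  intro z hz
  by_contra hne
  simp only [Set.mem_insert_iff, Set.mem_singleton_iff, not_or] at hne
  refine hz (.of_mul_eq_one (((z - l) * (z - μ))⁻¹ •
    (A + (z - l - μ) • (1 : Matrix m m ℂ))) ?_)
  have hc : (z - l) * (z - μ) ≠ 0 := mul_ne_zero (sub_ne_zero.2 hne.1) (sub_ne_zero.2 hne.2)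
  rw [mul_smul_comm, inv_smul_eq_iff₀ hc, Algebra.algebraMap_eq_smul_one]
  have hq : A * A = (l + μ) • A - (l * μ) • (1 : Matrix m m ℂ) := by
    rw [← sub_eq_zero, ← h]
    simp only [sub_mul, mul_sub, smul_mul_assoc, mul_smul_comm, one_mul, mul_one]
    module
  simp only [sub_mul, mul_add, smul_mul_assoc, mul_smul_comm, one_mul, mul_one, hq]
  module

/-- Normal targeting with spectrum in `{λ, μ}`: assuming the nondegeneracy condition,
there is a normal `A` with `spectrum A ⊆ {λ, μ}` and `A X = Y` iff
`(Y − λX)ᴴ (Y − μX) = 0`. -/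
theorem stmt_19 (m n : ℕ) (hn : 0 < n) (hmn : n ≤ m)
    (X Y : Matrix (Fin m) (Fin n) ℂ) (hX : X ≠ 0)
    (l μ : ℂ) (hlμ : l ≠ μ)
    (hdeg : (m = n ∧ (Y = l • X ∨ Y = μ • X)) → X.rank < m) :
    (∃ A : Matrix (Fin m) (Fin m) ℂ,
        A * Aᴴ = Aᴴ * A ∧ spectrum ℂ A ⊆ {l, μ} ∧ A * X = Y) ↔
      (Y - l • X)ᴴ * (Y - μ • X) = 0 := by
  constructor
  · rintro ⟨A, hA, hs, rfl⟩
    have hsub (c : ℂ) : A * X - c • X = (A - c • (1 : Matrix (Fin m) (Fin m) ℂ)) * X := by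
      rw [Matrix.sub_mul, Matrix.smul_mul, Matrix.one_mul]
    rw [hsub, hsub, conjTranspose_mul, Matrix.mul_assoc, ← Matrix.mul_assoc _ _ X,
      conjTranspose_sub_mul_sub_eq_zero_of_spectrum_subset_pair hA hs, Matrix.zero_mul,
      Matrix.mul_zero]
  · intro h
    obtain ⟨P, hP, hPP, hU, hV⟩ := exists_isHermitian_idempotent_mul_eq_self_and_mul_eq_zero _ _ h
    refine ⟨μ • 1 + (l - μ) • P, ?_, spectrum_subset_pair_of_sub_mul_sub_eq_zero ?_, ?_⟩
    · simp only [conjTranspose_add, conjTranspose_smul, conjTranspose_one, hP.eq, add_mul, mul_add,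
        smul_mul_assoc, mul_smul_comm, one_mul, mul_one]
      module
    · simp only [sub_mul, mul_sub, add_mul, mul_add, smul_mul_assoc, mul_smul_comm, one_mul,
        mul_one, hPP]
      module
    · rw [Matrix.mul_sub, Matrix.mul_smul, sub_eq_iff_eq_add] at hU hV
      have hPX : (l - μ) • (P * X) = Y - μ • X := by
        rw [sub_smul, ← sub_eq_zero]
        rw [hV, zero_add] at hU
        rw [hU]
        module
      rw [Matrix.add_mul, Matrix.smul_mul, Matrix.smul_mul, Matrix.one_mul, hPX]
      module
end
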